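/- Let L be a full-rank lattice in ℝ^n, s > 0, and x ∈ ℝ^n with r_x = dist(x, L). Let c ≥ 1 and τ = s·√(n/(2π)). Then the identity 2·(e^{1−c²})^{n/2} = 2·e^{n/2}·e^{(π/s²)(r_x² − c²τ²)}·ρ_s(r_x) holds; consequently, under the hypotheses n ≥ 500, k ≥ 1.04, r_x ≥ c·τ and λ_1(L) ≥ k·c·τ, one has ρ_s(r_x) ≤ ρ_s(L + x)/ρ_s(L) ≤ 2·e^{n/2}·e^{(π/s²)(r_x² − c²τ²)}·ρ_s(r_x). -/

import Mathlib

open MeasureTheory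

/-- The Gaussian function `ρ_s(x) = exp(-π‖x‖²/s²)` on `ℝ^n`. -/
noncomputable def rho {n : ℕ} (s : ℝ) (x : EuclideanSpace ℝ (Fin n)) : ℝ :=
  Real.exp (-Real.pi * ‖x‖ ^ 2 / s ^ 2)

/-- The Gaussian mass `ρ_s(S) = ∑_{v ∈ S} ρ_s(v)` of a set `S ⊆ ℝ^n`. -/
noncomputable def rhoSet {n : ℕ} (s : ℝ) (S : Set (EuclideanSpace ℝ (Fin n))) : ℝ :=
  ∑' v : S, rho s (v : EuclideanSpace ℝ (Fin n))

/-- The coset `L + t = {v + t : v ∈ L}`. -/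
def coset {n : ℕ} (L : Submodule ℤ (EuclideanSpace ℝ (Fin n)))
    (t : EuclideanSpace ℝ (Fin n)) : Set (EuclideanSpace ℝ (Fin n)) :=
  (fun v => v + t) '' (L : Set (EuclideanSpace ℝ (Fin n)))

/-- `λ₁(L)`, the length of a shortest nonzero vector of `L`. -/
noncomputable def lambdaOne {n : ℕ} (L : Submodule ℤ (EuclideanSpace ℝ (Fin n))) : ℝ :=
  sInf {r : ℝ | ∃ v : EuclideanSpace ℝ (Fin n), v ∈ L ∧ v ≠ 0 ∧ ‖v‖ = r}

/-- The Gaussian function evaluated at a real radius: `ρ_s(r) = exp(-π r²/s²)`. -/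
noncomputable def rhoR (s r : ℝ) : ℝ :=
  Real.exp (-Real.pi * r ^ 2 / s ^ 2)


lemma real_mul_summable {α β : Type*} {f : α → ℝ} {g : β → ℝ} (hf : Summable f)
    (hg : Summable g) :
    Summable (fun p : α × β => f p.1 * g p.2) ∧
      ∑' p : α × β, f p.1 * g p.2 = (∑' a, f a) * ∑' b, g b :=
  have hf' : Summable fun a => ‖f a‖ := hf.abs
  have hg' : Summable fun a => ‖g a‖ := hg.abs
  ⟨summable_mul_of_summable_norm hf' hg', (tsum_mul_tsum_of_summable_norm hf' hg').symm⟩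

/-- Quadratic form of a "congruent mod 2" kernel is nonnegative. -/
lemma tsum_add_sub_nonneg_aux {A Q : Type*} [AddCommGroup A] (h2 : ∀ a : A, a + a = 0 → a = 0)
    (φ : A → Q) (hφ0 : ∀ p q, φ q = φ p ↔ ∃ u, q + u + u = p) (D : A → ℝ) (hD : Summable D) :
    0 ≤ ∑' p : A × A, D (p.1 + p.2) * D (p.1 - p.2) := by
  have hφ : ∀ v w : A, φ (v - w) = φ (v + w) := by
    intro v w
    refine (hφ0 _ _).2 ⟨w, ?_⟩
    abel
  let T : A × A → (Σ c : Q, {a // φ a = c} × {a // φ a = c}) := fun p =>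
    ⟨φ (p.1 + p.2), ⟨p.1 + p.2, rfl⟩, ⟨p.1 - p.2, hφ _ _⟩⟩
  have inj0 : Function.Injective (fun p : A × A => (p.1 + p.2, p.1 - p.2)) := by
    rintro ⟨v, w⟩ ⟨v', w'⟩ h
    simp only [Prod.mk.injEq] at h
    obtain ⟨h3, h4⟩ := h
    have hv : v - v' = 0 := by
      apply h2
      have : (v - v') + (v - v') = (v + w) + (v - w) - ((v' + w') + (v' - w')) := by abel
      rw [this, h3, h4, sub_self]
    have hv : v = v' := sub_eq_zero.1 hv
    subst hv
    simpa using h3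
  have hT : Function.Bijective T := by
    constructor
    · intro p q h
      apply inj0
      have := congrArg (fun s : (Σ c : Q, {a // φ a = c} × {a // φ a = c}) =>
        (s.2.1.1, s.2.2.1)) h
      exact this
    · rintro ⟨c, ⟨p, rfl⟩, ⟨q, hq⟩⟩
      obtain ⟨u, hu⟩ := (hφ0 _ _).1 hq
      refine ⟨(q + u, u), ?_⟩
      have key : ∀ (a b : A) (h : φ b = φ a), a = p → b = q →
          (⟨φ a, ⟨a, rfl⟩, ⟨b, h⟩⟩ : (Σ c : Q, {a // φ a = c} × {a // φ a = c})) =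
          ⟨φ p, ⟨p, rfl⟩, ⟨q, hq⟩⟩ := by
        rintro a b h rfl rfl
        rfl
      apply key
      · exact hu
      · simp
  obtain ⟨e, he⟩ : ∃ e : A × A ≃ (Σ c : Q, {a // φ a = c} × {a // φ a = c}), ∀ p, e p = T p :=
    ⟨Equiv.ofBijective T hT, fun _ => rfl⟩
  let F : (Σ c : Q, {a // φ a = c} × {a // φ a = c}) → ℝ := fun s => D s.2.1.1 * D s.2.2.1
  have hsum0 : Summable fun p : A × A => D p.1 * D p.2 :=
    (real_mul_summable hD hD).1
  have hsum1 : Summable fun p : A × A => D (p.1 + p.2) * D (p.1 - p.2) :=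
    hsum0.comp_injective (i := fun p : A × A => (p.1 + p.2, p.1 - p.2)) inj0
  have hFe : ∀ p : A × A, F (e p) = D (p.1 + p.2) * D (p.1 - p.2) := by
    intro p
    rw [he]
  have hF : Summable F := by
    rw [← e.summable_iff]
    exact hsum1.congr fun p => (hFe p).symm
  have : ∑' p : A × A, D (p.1 + p.2) * D (p.1 - p.2) = ∑' s, F s := by
    rw [← e.tsum_eq F]
    exact tsum_congr fun p => (hFe p).symm
  rw [this, hF.tsum_sigma]
  refine tsum_nonneg fun c => ?_
  have hc : Summable fun a : {a // φ a = c} => D a.1 := hD.subtype _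
  have := (real_mul_summable hc hc).2
  change 0 ≤ ∑' (s : {a // φ a = c} × {a // φ a = c}), D s.1.1 * D s.2.1
  rw [this]
  exact mul_self_nonneg _

lemma tsum_add_sub_nonneg {A : Type*} [AddCommGroup A] (h2 : ∀ a : A, a + a = 0 → a = 0)
    (D : A → ℝ) (hD : Summable D) :
    0 ≤ ∑' p : A × A, D (p.1 + p.2) * D (p.1 - p.2) := by
  refine tsum_add_sub_nonneg_aux h2
    (fun a => (QuotientAddGroup.mk a : A ⧸ (zsmulAddGroupHom (α := A) 2).range)) ?_ D hD
  intro p q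
  rw [QuotientAddGroup.eq]
  constructor
  · rintro ⟨u, hu⟩
    rw [zsmulAddGroupHom_apply, two_zsmul] at hu
    exact ⟨u, by rw [add_assoc, hu]; abel⟩
  · rintro ⟨u, hu⟩
    refine ⟨u, ?_⟩
    rw [zsmulAddGroupHom_apply, two_zsmul, ← hu]
    abel

/-- Periodized Gaussian. -/
noncomputable def perG {n : ℕ} (L : Submodule ℤ (EuclideanSpace ℝ (Fin n))) (b : ℝ)
    (x : EuclideanSpace ℝ (Fin n)) : ℝ :=
  ∑' v : L, Real.exp (-b * ‖(v : EuclideanSpace ℝ (Fin n)) + x‖ ^ 2)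

section
variable {n : ℕ} (L : Submodule ℤ (EuclideanSpace ℝ (Fin n)))

lemma perG_summable [DiscreteTopology L] {b : ℝ} (hb : 0 < b)
    (x : EuclideanSpace ℝ (Fin n)) :
    Summable fun v : L => Real.exp (-b * ‖(v : EuclideanSpace ℝ (Fin n)) + x‖ ^ 2) := by
  let m := Module.finrank ℤ L + 1
  have h := ZLattice.summable_norm_sub_inv_pow L (2 * m) (by omega) (-x)
  have h' : Summable fun v : L =>
      (m.factorial / b ^ m : ℝ) * ‖(v : EuclideanSpace ℝ (Fin n)) - -x‖⁻¹ ^ (2 * m) :=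
    h.mul_left _
  refine Summable.of_norm_bounded_eventually h' ?_
  have hfin : {v : L | (v : EuclideanSpace ℝ (Fin n)) + x = 0}.Finite := by
    apply Set.Subsingleton.finite
    intro v hv w hw
    simp only [Set.mem_ofPred_eq] at hv hw
    exact Subtype.ext (add_right_cancel (hv.trans hw.symm))
  filter_upwards [hfin.compl_mem_cofinite] with v hv
  have hv' : 0 < ‖(v : EuclideanSpace ℝ (Fin n)) + x‖ := norm_pos_iff.2 hv
  rw [sub_neg_eq_add, Real.norm_of_nonneg (Real.exp_pos _).le]
  set r := ‖(v : EuclideanSpace ℝ (Fin n)) + x‖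
  have h1 := Real.pow_div_factorial_le_exp (b * r ^ 2) (by positivity) m
  have h2 : (0:ℝ) < (b * r ^ 2) ^ m / m.factorial := by positivity
  rw [neg_mul, Real.exp_neg]
  calc (Real.exp (b * r ^ 2))⁻¹ ≤ ((b * r ^ 2) ^ m / m.factorial)⁻¹ := inv_anti₀ h2 h1
    _ = _ := by rw [mul_pow, ← pow_mul, inv_div, inv_pow]; field_simp

lemma perG_nonneg (b : ℝ) (x : EuclideanSpace ℝ (Fin n)) : 0 ≤ perG L b x :=
  tsum_nonneg fun _ => (Real.exp_pos _).le

lemma perG_add (b : ℝ) (x : EuclideanSpace ℝ (Fin n)) (y : L) :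
    perG L b (y + x) = perG L b x := by
  unfold perG
  rw [← (Equiv.addRight y).tsum_eq (fun v : L =>
    Real.exp (-b * ‖(v : EuclideanSpace ℝ (Fin n)) + x‖ ^ 2))]
  simp [add_assoc]

lemma perG_neg (b : ℝ) (x : EuclideanSpace ℝ (Fin n)) :
    perG L b (-x) = perG L b x := by
  unfold perG
  rw [← (Equiv.neg L).tsum_eq (fun v : L =>
    Real.exp (-b * ‖(v : EuclideanSpace ℝ (Fin n)) + x‖ ^ 2))]
  refine tsum_congr fun v => ?_
  have : ((Equiv.neg L v : L) : EuclideanSpace ℝ (Fin n)) + x = -((v : EuclideanSpace ℝ (Fin n)) + -x) := by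
    simp [add_comm]
  rw [this, norm_neg]

lemma perG_bdd [DiscreteTopology L] [IsZLattice ℝ L] {b : ℝ} (hb : 0 < b) :
    ∃ M, ∀ x, perG L b x ≤ M := by
  let B := (Module.Free.chooseBasis ℤ L).ofZLatticeBasis ℝ L
  have hB : Submodule.span ℤ (Set.range B) = L :=
    (Module.Free.chooseBasis ℤ L).ofZLatticeBasis_span ℝ
  let R := ∑ i, ‖B i‖
  refine ⟨Real.exp (b * R ^ 2) * perG L (b / 2) 0, fun x => ?_⟩
  let z := ZSpan.fract B x
  have hz : ‖z‖ ≤ R := ZSpan.norm_fract_le B x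
  have hy : ((ZSpan.floor B x : Submodule.span ℤ (Set.range B)) : EuclideanSpace ℝ (Fin n)) ∈ L := by
    exact hB.le (ZSpan.floor B x).2
  have hxz : x = ((⟨_, hy⟩ : L) : EuclideanSpace ℝ (Fin n)) + z := by
    simp [z, ZSpan.fract_apply]
  rw [hxz, perG_add]
  unfold perG
  rw [← tsum_mul_left]
  refine (perG_summable L hb z).tsum_le_tsum (fun v => ?_)
    ((perG_summable L (half_pos hb) 0).mul_left _)
  rw [← Real.exp_add, Real.exp_le_exp, add_zero]
  have h1 : ‖(v : EuclideanSpace ℝ (Fin n))‖ ≤ ‖(v : EuclideanSpace ℝ (Fin n)) + z‖ + ‖z‖ := by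
    simpa using norm_sub_le ((v : EuclideanSpace ℝ (Fin n)) + z) z
  have h2 : ‖(v : EuclideanSpace ℝ (Fin n))‖ ^ 2 ≤
      2 * ‖(v : EuclideanSpace ℝ (Fin n)) + z‖ ^ 2 + 2 * R ^ 2 := by
    nlinarith [sq_nonneg (‖(v : EuclideanSpace ℝ (Fin n)) + z‖ - ‖z‖), norm_nonneg z,
      norm_nonneg (v : EuclideanSpace ℝ (Fin n)), norm_nonneg ((v : EuclideanSpace ℝ (Fin n)) + z)]
  nlinarith

lemma perG_quad [DiscreteTopology L] {b : ℝ} (hb : 0 < b) (x : EuclideanSpace ℝ (Fin n)) :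
    2 * perG L b x ^ 2 ≤ perG L b (x + x) * perG L b 0 + perG L b 0 ^ 2 := by
  let g : EuclideanSpace ℝ (Fin n) → ℝ := fun y => Real.exp (-(b / 2) * ‖y‖ ^ 2)
  let h : EuclideanSpace ℝ (Fin n) → ℝ := fun y => Real.exp (-b * ‖y‖ ^ 2)
  have hg : ∀ p q u w : EuclideanSpace ℝ (Fin n), p = u + w → q = u - w → g p * g q = h u * h w := by
    rintro p q u w rfl rfl
    simp only [g, h, ← Real.exp_add]
    congr 1
    have := parallelogram_law_with_norm ℝ u w
    nlinarith
  let D : L → ℝ := fun p => g (p + (x + x)) - g (p + 0)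
  have hD : Summable D :=
    (perG_summable L (half_pos hb) (x + x)).sub (perG_summable L (half_pos hb) 0)
  have h2 : ∀ a : L, a + a = 0 → a = 0 := by
    intro a ha
    have h0 : (a : EuclideanSpace ℝ (Fin n)) + a = 0 := congrArg Subtype.val ha
    rw [← two_smul ℝ] at h0
    exact Subtype.ext ((smul_eq_zero.1 h0).resolve_left two_ne_zero)
  have key := tsum_add_sub_nonneg h2 D hD
  have hs : ∀ y z : EuclideanSpace ℝ (Fin n),
      Summable (fun p : L × L => h (p.1 + y) * h (p.2 + z)) ∧
      ∑' p : L × L, h (p.1 + y) * h (p.2 + z) = perG L b y * perG L b z := by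
    intro y z
    have hy : Summable fun v : L => h (v + y) := perG_summable L hb y
    have hz : Summable fun v : L => h (v + z) := perG_summable L hb z
    have hyz := real_mul_summable hy hz
    refine ⟨hyz.1, hyz.2⟩
  have hexp : ∀ p : L × L, D (p.1 + p.2) * D (p.1 - p.2) =
      h (p.1 + (x + x)) * h (p.2 + 0) - h (p.1 + x) * h (p.2 + x)
       - h (p.1 + x) * h (p.2 + -x) + h (p.1 + 0) * h (p.2 + 0) := by
    rintro ⟨v, w⟩
    have e1 := hg ((v : EuclideanSpace ℝ (Fin n)) + w + (x + x)) ((v : EuclideanSpace ℝ (Fin n)) - w + (x + x)) (v + (x + x)) (w + 0)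
      (by abel) (by abel)
    have e2 := hg ((v : EuclideanSpace ℝ (Fin n)) + w + (x + x)) ((v : EuclideanSpace ℝ (Fin n)) - w + 0) (v + x) (w + x)
      (by abel) (by abel)
    have e3 := hg ((v : EuclideanSpace ℝ (Fin n)) + w + 0) ((v : EuclideanSpace ℝ (Fin n)) - w + (x + x)) (v + x) (w + -x)
      (by abel) (by abel)
    have e4 := hg ((v : EuclideanSpace ℝ (Fin n)) + w + 0) ((v : EuclideanSpace ℝ (Fin n)) - w + 0) (v + 0) (w + 0)
      (by abel) (by abel)
    simp only [D, Submodule.coe_add, Submodule.coe_sub]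
    rw [← e1, ← e2, ← e3, ← e4]
    ring
  simp_rw [hexp] at key
  obtain ⟨s1, t1⟩ := hs (x + x) 0
  obtain ⟨s2, t2⟩ := hs x x
  obtain ⟨s3, t3⟩ := hs x (-x)
  obtain ⟨s4, t4⟩ := hs 0 0
  rw [((s1.sub s2).sub s3).tsum_add s4, (s1.sub s2).tsum_sub s3, s1.tsum_sub s2, t1, t2, t3, t4,
    perG_neg] at key
  nlinarith

lemma one_le_perG_zero [DiscreteTopology L] {b : ℝ} (hb : 0 < b) : 1 ≤ perG L b 0 := by
  have := (perG_summable L hb 0).le_tsum (0 : L) (fun _ _ => (Real.exp_pos _).le)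
  simpa [perG] using this

lemma perG_le_zero [DiscreteTopology L] [IsZLattice ℝ L] {b : ℝ} (hb : 0 < b)
    (x : EuclideanSpace ℝ (Fin n)) : perG L b x ≤ perG L b 0 := by
  obtain ⟨M0, hM0⟩ := perG_bdd L hb
  have hbdd : BddAbove (Set.range (perG L b)) := ⟨M0, by rintro _ ⟨y, rfl⟩; exact hM0 y⟩
  set M := ⨆ y, perG L b y with hM
  have hle : ∀ y, perG L b y ≤ M := fun y => le_ciSup hbdd y
  have h1 := one_le_perG_zero L hb
  set f0 := perG L b 0 with hf0
  by_contra! hx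
  have hMf : f0 < M := hx.trans_le (hle x)
  have h2 : ∀ y, perG L b y ≤ Real.sqrt ((M * f0 + f0 ^ 2) / 2) := by
    intro y
    apply Real.le_sqrt_of_sq_le
    have := perG_quad L hb y
    nlinarith [hle (y + y)]
  have h3 : M ≤ Real.sqrt ((M * f0 + f0 ^ 2) / 2) := ciSup_le h2
  have h4 : M ^ 2 ≤ (M * f0 + f0 ^ 2) / 2 := by
    rw [← Real.le_sqrt' (by linarith)]; exact h3
  nlinarith

lemma gauss_conv {b d : ℝ} (hb : 0 < b) (hd : 0 < d) (v : EuclideanSpace ℝ (Fin n)) :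
    ∫ y : EuclideanSpace ℝ (Fin n), Real.exp (-b * ‖v + y‖ ^ 2) * Real.exp (-d * ‖y‖ ^ 2) =
      (Real.pi / (b + d)) ^ ((n : ℝ) / 2) * Real.exp (-(b * d / (b + d)) * ‖v‖ ^ 2) := by
  have hbd : 0 < b + d := by positivity
  have h := GaussianFourier.integral_cexp_neg_mul_sq_norm_add (V := EuclideanSpace ℝ (Fin n))
    (b := ((b + d : ℝ) : ℂ)) (by simpa using hbd) ((-2 * b : ℝ) : ℂ) v
  have h' : ∫ y : EuclideanSpace ℝ (Fin n), Real.exp (-(b + d) * ‖y‖ ^ 2 + (-2 * b) * inner ℝ v y) =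
      (Real.pi / (b + d)) ^ ((n : ℝ) / 2) * Real.exp ((-2 * b) ^ 2 * ‖v‖ ^ 2 / (4 * (b + d))) := by
    rw [← Complex.ofReal_inj, ← integral_complex_ofReal]
    rw [Complex.ofReal_mul, Complex.ofReal_cpow (by positivity)]
    push_cast at h ⊢
    simpa using h
  calc _ = ∫ y : EuclideanSpace ℝ (Fin n), Real.exp (-b * ‖v‖ ^ 2) *
        Real.exp (-(b + d) * ‖y‖ ^ 2 + (-2 * b) * inner ℝ v y) := by
        congr 1; ext y
        rw [← Real.exp_add, ← Real.exp_add, norm_add_sq_real]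
        congr 1; ring
    _ = _ := by
        rw [integral_const_mul, h', mul_left_comm, ← Real.exp_add]
        congr 2; field_simp; ring

lemma perG_scale [DiscreteTopology L] [IsZLattice ℝ L] {b d : ℝ} (hb : 0 < b) (hd : 0 < d) :
    perG L (b * d / (b + d)) 0 ≤ ((b + d) / d) ^ ((n : ℝ) / 2) * perG L b 0 := by
  have hbd : 0 < b + d := by positivity
  refine (perG_summable L (by positivity) 0).tsum_le_of_sum_le fun F => ?_
  have hI : ∀ v : EuclideanSpace ℝ (Fin n), Integrable fun y : EuclideanSpace ℝ (Fin n) =>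
      Real.exp (-b * ‖v + y‖ ^ 2) * Real.exp (-d * ‖y‖ ^ 2) := by
    intro v
    apply Integrable.of_integral_ne_zero
    rw [gauss_conv hb hd]
    positivity
  have hG := GaussianFourier.integral_rexp_neg_mul_sq_norm (V := EuclideanSpace ℝ (Fin n)) hd
  have hGI : Integrable fun y : EuclideanSpace ℝ (Fin n) => Real.exp (-d * ‖y‖ ^ 2) := by
    apply Integrable.of_integral_ne_zero
    rw [hG]
    positivity
  have h1 : ∫ y : EuclideanSpace ℝ (Fin n), ∑ v ∈ F,
      Real.exp (-b * ‖(v : EuclideanSpace ℝ (Fin n)) + y‖ ^ 2) * Real.exp (-d * ‖y‖ ^ 2) ≤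
      ∫ y : EuclideanSpace ℝ (Fin n), perG L b 0 * Real.exp (-d * ‖y‖ ^ 2) := by
    apply integral_mono (integrable_finsetSum F fun v _ => hI (v : EuclideanSpace ℝ (Fin n))) (hGI.const_mul _)
    intro y
    simp only
    rw [← Finset.sum_mul]
    gcongr
    exact ((perG_summable L hb y).sum_le_tsum F fun _ _ => (Real.exp_pos _).le).trans
      (perG_le_zero L hb y)
  rw [integral_finsetSum F fun v _ => hI (v : EuclideanSpace ℝ (Fin n)), integral_const_mul, hG] at h1
  simp_rw [gauss_conv hb hd] at h1
  rw [← Finset.mul_sum, finrank_euclideanSpace_fin] at h1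
  simp only [add_zero]
  have hp : 0 < (Real.pi / (b + d)) ^ ((n : ℝ) / 2) := by positivity
  have he : (Real.pi / d) ^ ((n : ℝ) / 2) =
      (Real.pi / (b + d)) ^ ((n : ℝ) / 2) * ((b + d) / d) ^ ((n : ℝ) / 2) := by
    rw [← Real.mul_rpow (by positivity) (by positivity)]
    congr 1; field_simp
  rw [he] at h1
  refine le_of_mul_le_mul_left (h1.trans_eq ?_) hp
  ring

lemma perG_lower [DiscreteTopology L] {b : ℝ} (hb : 0 < b) (z : EuclideanSpace ℝ (Fin n)) :
    Real.exp (-b * ‖z‖ ^ 2) * perG L b 0 ≤ perG L b z := by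
  have h : 2 * (Real.exp (-b * ‖z‖ ^ 2) * perG L b 0) ≤ perG L b z + perG L b (-z) := by
    unfold perG
    rw [← (perG_summable L hb z).tsum_add (perG_summable L hb (-z)), ← tsum_mul_left,
      ← tsum_mul_left]
    refine (((perG_summable L hb 0).mul_left _).mul_left _).tsum_le_tsum (fun v => ?_)
      ((perG_summable L hb z).add (perG_summable L hb (-z)))
    have hl := parallelogram_law_with_norm ℝ (v : EuclideanSpace ℝ (Fin n)) z
    rw [← Real.exp_add, add_zero, ← sub_eq_add_neg]
    set p := ‖(v : EuclideanSpace ℝ (Fin n)) + z‖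
    set q := ‖(v : EuclideanSpace ℝ (Fin n)) - z‖
    have e1 : -b * ‖z‖ ^ 2 + -b * ‖(v : EuclideanSpace ℝ (Fin n))‖ ^ 2 =
      (-b * p ^ 2) / 2 + (-b * q ^ 2) / 2 := by nlinarith
    have e2 : ∀ t : ℝ, Real.exp t = Real.exp (t / 2) ^ 2 := by
      intro t; rw [← Real.exp_nat_mul]; congr 1; push_cast; ring
    rw [e1, Real.exp_add, e2 (-b * p ^ 2), e2 (-b * q ^ 2)]
    nlinarith [sq_nonneg (Real.exp (-b * p ^ 2 / 2) - Real.exp (-b * q ^ 2 / 2))]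
  rw [perG_neg] at h
  linarith

lemma num_bound (hn : 500 ≤ n) :
    Real.exp (-((1.0816 - 1) * ((n : ℝ) / 2))) * (1.0816 : ℝ) ^ ((n : ℝ) / 2) ≤ 1 / 2 := by
  have hn' : (500 : ℝ) ≤ n := by exact_mod_cast hn
  have hl : Real.log 1.0816 ≤ 0.0788 := by
    rw [Real.log_le_iff_le_exp (by norm_num)]
    refine le_trans ?_ (Real.sum_le_exp_of_nonneg (by norm_num) 4)
    norm_num [Finset.sum_range_succ, Nat.factorial]
  rw [Real.rpow_def_of_pos (by norm_num), ← Real.exp_add]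
  have : -((1.0816 - 1) * ((n : ℝ) / 2)) + Real.log 1.0816 * ((n : ℝ) / 2) ≤ -0.7 := by
    nlinarith
  refine (Real.exp_le_exp.2 this).trans ?_
  rw [Real.exp_neg, one_div]
  apply inv_anti₀ (by norm_num)
  refine le_trans ?_ (Real.sum_le_exp_of_nonneg (by norm_num) 5)
  norm_num [Finset.sum_range_succ, Nat.factorial]

lemma perG_le_two [DiscreteTopology L] [IsZLattice ℝ L] {b : ℝ} (hb : 0 < b) (hn : 500 ≤ n)
    (hL : ∀ v : L, v ≠ 0 → 1.0816 * ((n : ℝ) / 2) ≤ b * ‖(v : EuclideanSpace ℝ (Fin n))‖ ^ 2) :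
    perG L b 0 ≤ 2 := by
  classical
  have hd : 0 < b / 0.0816 := by positivity
  have hsc := perG_scale L hb hd
  have e1 : b * (b / 0.0816) / (b + b / 0.0816) = b / 1.0816 := by field_simp; norm_num
  have e2 : (b + b / 0.0816) / (b / 0.0816) = 1.0816 := by field_simp; norm_num
  rw [e1, e2] at hsc
  have hb' : 0 < b / 1.0816 := by positivity
  set ε := Real.exp (-((1.0816 - 1) * ((n : ℝ) / 2))) with hε
  have h1 : perG L b 0 ≤ 1 + ε * perG L (b / 1.0816) 0 := by
    have hs1 := hasSum_ite_eq (0 : L) (1 : ℝ)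
    have hs2 := (perG_summable L hb' 0).hasSum.mul_left ε
    refine hasSum_le (fun v => ?_) (perG_summable L hb 0).hasSum (hs1.add hs2)
    by_cases hv : v = 0
    · subst hv
      simp only [if_true]
      have : (0:ℝ) ≤ ε * Real.exp (-(b / 1.0816) * ‖((0 : L) : EuclideanSpace ℝ (Fin n)) + 0‖ ^ 2) := by positivity
      simp at this ⊢
      exact this
    · rw [if_neg hv, zero_add, hε, ← Real.exp_add, Real.exp_le_exp, add_zero]
      have := hL v hv
      have e3 : -b * ‖(v : EuclideanSpace ℝ (Fin n))‖ ^ 2 = -(0.0816 / 1.0816) * (b * ‖(v : EuclideanSpace ℝ (Fin n))‖ ^ 2) + -(b / 1.0816) * ‖(v : EuclideanSpace ℝ (Fin n))‖ ^ 2 := by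
        ring
      rw [e3]
      linarith
  have h2 := num_bound hn
  rw [← hε] at h2
  have h3 : ε * perG L (b / 1.0816) 0 ≤ 1 / 2 * perG L b 0 := by
    calc _ ≤ ε * ((1.0816 : ℝ) ^ ((n : ℝ) / 2) * perG L b 0) := by gcongr
      _ = (ε * (1.0816 : ℝ) ^ ((n : ℝ) / 2)) * perG L b 0 := by ring
      _ ≤ _ := by
        gcongr
        exact perG_nonneg _ _ _
  linarith

lemma rhoSet_coset (s : ℝ) (x : EuclideanSpace ℝ (Fin n)) :
    rhoSet s (coset L x) = perG L (Real.pi / s ^ 2) x := by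
  unfold rhoSet coset perG
  rw [tsum_image (f := rho s) (add_left_injective x).injOn]
  refine tsum_congr fun v => ?_
  unfold rho
  congr 1
  ring

lemma rhoSet_lattice (s : ℝ) :
    rhoSet s (L : Set (EuclideanSpace ℝ (Fin n))) = perG L (Real.pi / s ^ 2) 0 := by
  unfold rhoSet perG
  refine tsum_congr fun v => ?_
  unfold rho
  rw [add_zero]
  congr 1
  ring

end

/-- Unified form of the improved distinguishing inequality:
`2(e^{1-c²})^{n/2} = 2e^{n/2}·e^{(π/s²)(r_x² - c²τ²)}·ρ_s(r_x)`, and under the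
hypotheses `n ≥ 500`, `k ≥ 1.04`, `r_x ≥ cτ`, `λ₁(L) ≥ kcτ`, one has
`ρ_s(r_x) ≤ ρ_s(L+x)/ρ_s(L) ≤ 2e^{n/2}·e^{(π/s²)(r_x² - c²τ²)}·ρ_s(r_x)`. -/
theorem distinguishing_unified (n : ℕ)
    (L : Submodule ℤ (EuclideanSpace ℝ (Fin n))) [DiscreteTopology L] [IsZLattice ℝ L]
    (s : ℝ) (hs : 0 < s) (x : EuclideanSpace ℝ (Fin n)) (rx τ : ℝ)
    (hrx : rx = Metric.infDist x (L : Set (EuclideanSpace ℝ (Fin n))))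
    (hτ : τ = s * Real.sqrt (n / (2 * Real.pi)))
    (c : ℝ) (hc : 1 ≤ c) (k : ℝ) :
    2 * Real.exp (1 - c ^ 2) ^ ((n : ℝ) / 2) =
        2 * Real.exp ((n : ℝ) / 2) *
          Real.exp (Real.pi / s ^ 2 * (rx ^ 2 - c ^ 2 * τ ^ 2)) * rhoR s rx ∧
      (500 ≤ n → 1.04 ≤ k → c * τ ≤ rx → k * c * τ ≤ lambdaOne L →
        rhoR s rx ≤
            rhoSet s (coset L x) / rhoSet s (L : Set (EuclideanSpace ℝ (Fin n))) ∧
          rhoSet s (coset L x) / rhoSet s (L : Set (EuclideanSpace ℝ (Fin n))) ≤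
            2 * Real.exp ((n : ℝ) / 2) *
              Real.exp (Real.pi / s ^ 2 * (rx ^ 2 - c ^ 2 * τ ^ 2)) * rhoR s rx) := by
  have hb : 0 < Real.pi / s ^ 2 := by positivity
  have hbτ : Real.pi / s ^ 2 * τ ^ 2 = (n : ℝ) / 2 := by
    rw [hτ, mul_pow, Real.sq_sqrt (by positivity)]
    field_simp
  have hτ0 : 0 ≤ τ := by rw [hτ]; positivity
  have hid : 2 * Real.exp (1 - c ^ 2) ^ ((n : ℝ) / 2) =
        2 * Real.exp ((n : ℝ) / 2) *
          Real.exp (Real.pi / s ^ 2 * (rx ^ 2 - c ^ 2 * τ ^ 2)) * rhoR s rx := by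
    unfold rhoR
    rw [← Real.exp_mul, mul_assoc, mul_assoc, ← Real.exp_add, ← Real.exp_add]
    congr 2
    linear_combination c ^ 2 * hbτ
  refine ⟨hid, fun hn hk hcr hlam => ?_⟩
  rw [← hid, rhoSet_coset, rhoSet_lattice]
  set b := Real.pi / s ^ 2 with hbdef
  have hG0 := one_le_perG_zero L hb
  have hG0' : 0 < perG L b 0 := by linarith
  have hc0 : 0 < c := by linarith
  constructor
  · rw [le_div_iff₀ hG0']
    have hcl : IsClosed (L : Set (EuclideanSpace ℝ (Fin n))) :=
      @AddSubgroup.isClosed_of_discrete _ _ _ _ _ L.toAddSubgroup ‹_›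
    obtain ⟨y, hy, hxy⟩ := hcl.exists_infDist_eq_dist ⟨0, L.zero_mem⟩ x
    have h1 := perG_lower L hb (x - y)
    have h2 := perG_add L b (x - y) ⟨y, hy⟩
    simp only [add_sub_cancel] at h2
    rw [h2]
    rw [← dist_eq_norm, ← hxy, ← hrx] at h1
    refine le_trans (le_of_eq ?_) h1
    unfold rhoR
    congr 2
    rw [hbdef]; ring
  · have hb' : 0 < b / c ^ 2 := by positivity
    have h2 : perG L (b / c ^ 2) 0 ≤ 2 := by
      refine perG_le_two L hb' hn fun v hv => ?_
      have hv1 : lambdaOne L ≤ ‖(v : EuclideanSpace ℝ (Fin n))‖ := by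
        refine csInf_le ⟨0, ?_⟩ ⟨v, v.2, by simpa using hv, rfl⟩
        rintro _ ⟨w, _, _, rfl⟩
        exact norm_nonneg w
      have hv2 : 1.04 * (c * τ) ≤ ‖(v : EuclideanSpace ℝ (Fin n))‖ := by
        have : 1.04 * (c * τ) ≤ k * (c * τ) := by gcongr
        linarith
      have hv3 : (1.04 * (c * τ)) ^ 2 ≤ ‖(v : EuclideanSpace ℝ (Fin n))‖ ^ 2 := by gcongr
      calc 1.0816 * ((n : ℝ) / 2) = b / c ^ 2 * (1.04 * (c * τ)) ^ 2 := by
            rw [← hbτ]; field_simp; norm_num [mul_comm]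
        _ ≤ _ := by gcongr
    have h3 : perG L b x ≤ Real.exp (1 - c ^ 2) ^ ((n : ℝ) / 2) * perG L (b / c ^ 2) x := by
      unfold perG
      rw [← tsum_mul_left]
      refine (perG_summable L hb x).tsum_le_tsum (fun v => ?_)
        ((perG_summable L hb' x).mul_left _)
      rw [← Real.exp_mul, ← Real.exp_add, Real.exp_le_exp]
      have hv : rx ≤ ‖(v : EuclideanSpace ℝ (Fin n)) + x‖ := by
        have h := Metric.infDist_le_dist_of_mem (x := x) (L.neg_mem v.2)
        rw [hrx]
        refine h.trans_eq ?_
        rw [dist_eq_norm, sub_neg_eq_add, add_comm]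
      have hv3 : (c * τ) ^ 2 ≤ ‖(v : EuclideanSpace ℝ (Fin n)) + x‖ ^ 2 := by
        have := hcr.trans hv
        gcongr
      set r := ‖(v : EuclideanSpace ℝ (Fin n)) + x‖
      have hbb : 0 ≤ b - b / c ^ 2 := by
        rw [sub_nonneg]
        exact div_le_self hb.le (one_le_pow₀ hc)
      have h5 := mul_le_mul_of_nonneg_left hv3 hbb
      have h6 : (b - b / c ^ 2) * (c * τ) ^ 2 = (c ^ 2 - 1) * ((n : ℝ) / 2) := by
        rw [← hbτ]; field_simp
      linarith
    rw [div_le_iff₀ hG0']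
    have h4 := perG_le_zero L hb' x
    have hE : 0 < Real.exp (1 - c ^ 2) ^ ((n : ℝ) / 2) := by positivity
    calc perG L b x ≤ Real.exp (1 - c ^ 2) ^ ((n : ℝ) / 2) * perG L (b / c ^ 2) x := h3
      _ ≤ Real.exp (1 - c ^ 2) ^ ((n : ℝ) / 2) * 2 := by gcongr; linarith
      _ = 2 * Real.exp (1 - c ^ 2) ^ ((n : ℝ) / 2) * 1 := by ring
      _ ≤ _ := by gcongr
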